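/- arXiv:2603.04137 — 3 statements merged into one kernel-verified Lean document; each statement's English description precedes it below -/
import Mathlib

section
/- In the ring of formal power series in z over ℤ[t], the product identity g(t,z) · g(t,-z) = G(t²,z²) holds; that is, ∑_{n≥0} (∑_{i+j=n} (-1)^j c_{i+1}(t) c_{j+1}(t)) z^n equals the series whose coefficient of z^{2n} is C_{n+1}(t²) and whose odd coefficients vanish. -/
open Polynomial Finset

/-- `v n k = C(⌊(n-1)/2⌋, ⌊k/2⌋) * C(⌊n/2⌋, ⌊(k+1)/2⌋)` -/
def v (n k : ℕ) : ℕ := Nat.choose ((n - 1) / 2) (k / 2) * Nat.choose (n / 2) ((k + 1) / 2)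

/-- The polynomials `c n`, i.e. the q-Narayana polynomials at q = -1. -/
noncomputable def c : ℕ → Polynomial ℤ
  | 0 => 1
  | n + 1 => ∑ k ∈ Finset.range (n + 1), Polynomial.C (v (n + 1) k : ℤ) * Polynomial.X ^ k

/-- The Narayana numbers `N(n,k) = C(n,k)*C(n-1,k)/(k+1)`. -/
def naraNum (n k : ℕ) : ℕ := Nat.choose n k * Nat.choose (n - 1) k / (k + 1)

/-- The Narayana polynomials. -/
noncomputable def naraPoly : ℕ → Polynomial ℤ
  | 0 => 1
  | n + 1 => ∑ k ∈ Finset.range (n + 1), Polynomial.C (naraNum (n + 1) k : ℤ) * Polynomial.X ^ k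

/-- The Narayana polynomials of type B. -/
noncomputable def naraB (n : ℕ) : Polynomial ℤ :=
  ∑ k ∈ Finset.range (n + 1), Polynomial.C ((Nat.choose n k : ℤ) ^ 2) * Polynomial.X ^ k

/-- The companion of `naraB`: the generating polynomial of `C(n,k) * C(n,k+1)`. -/
noncomputable def adjacentChoosePoly (n : ℕ) : Polynomial ℤ :=
  ∑ k ∈ Finset.range (n + 1), Polynomial.C ((Nat.choose n k : ℤ) * Nat.choose n (k + 1)) *
    Polynomial.X ^ k

theorem coeff_naraB (n k : ℕ) : (naraB n).coeff k = (Nat.choose n k : ℤ) ^ 2 := by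
  simp only [naraB, finsetSum_coeff, coeff_C_mul_X_pow, Finset.sum_ite_eq, Finset.mem_range]
  split_ifs with h
  · rfl
  · simp [Nat.choose_eq_zero_of_lt (by omega : n < k)]

theorem coeff_adjacentChoosePoly (n k : ℕ) :
    (adjacentChoosePoly n).coeff k = (Nat.choose n k : ℤ) * Nat.choose n (k + 1) := by
  simp only [adjacentChoosePoly, finsetSum_coeff, coeff_C_mul_X_pow, Finset.sum_ite_eq,
    Finset.mem_range]
  split_ifs with h
  · rfl
  · simp [Nat.choose_eq_zero_of_lt (by omega : n < k)]

theorem coeff_c_succ (n k : ℕ) : (c (n + 1)).coeff k = (v (n + 1) k : ℤ) := by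
  simp only [c, finsetSum_coeff, coeff_C_mul_X_pow, Finset.sum_ite_eq, Finset.mem_range]
  split_ifs with h
  · rfl
  · symm
    rw [Nat.cast_eq_zero, v, mul_eq_zero]
    by_cases hk : (n + 1) / 2 < (k + 1) / 2
    · exact Or.inr (Nat.choose_eq_zero_of_lt hk)
    · exact Or.inl (Nat.choose_eq_zero_of_lt (by omega))

theorem choose_succ_mul_succ_int (n k : ℕ) :
    (Nat.choose n (k + 1) : ℤ) * (k + 1) = Nat.choose n k * (n - k) := by
  rcases le_or_gt k n with h | h
  · have := Nat.choose_succ_right_eq n k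
    zify [h] at this
    exact this
  · simp [Nat.choose_eq_zero_of_lt h, Nat.choose_eq_zero_of_lt (by omega : n < k + 1)]

theorem naraNum_succ_zero (n : ℕ) : naraNum (n + 1) 0 = 1 := by simp [naraNum]

theorem naraNum_succ_succ (n k : ℕ) :
    (naraNum (n + 1) (k + 1) : ℤ) =
      (Nat.choose n (k + 1) : ℤ) ^ 2 - Nat.choose n k * Nat.choose n (k + 2) := by
  have h₁ := choose_succ_mul_succ_int n k
  have h₂ := choose_succ_mul_succ_int n (k + 1)
  push_cast at h₂
  rw [naraNum, Nat.add_sub_cancel, Int.natCast_ediv]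
  refine Int.ediv_eq_of_eq_mul_left (by positivity) ?_
  rw [Nat.choose_succ_succ']
  push_cast
  linear_combination (Nat.choose n k : ℤ) * h₂ - (Nat.choose n (k + 1) : ℤ) * h₁

theorem coeff_naraPoly_succ (n k : ℕ) :
    (naraPoly (n + 1)).coeff k = (naraNum (n + 1) k : ℤ) := by
  simp only [naraPoly, finsetSum_coeff, coeff_C_mul_X_pow, Finset.sum_ite_eq, Finset.mem_range]
  split_ifs with h
  · rfl
  · simp [naraNum, Nat.choose_eq_zero_of_lt (by omega : n < k)]

theorem naraB_add_two_recurrence (n : ℕ) :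
    Polynomial.C ((n : ℤ) + 2) * naraB (n + 2) + Polynomial.C ((n : ℤ) + 1) *
        ((1 - Polynomial.X) ^ 2 * naraB n) =
      Polynomial.C (2 * (n : ℤ) + 3) * ((1 + Polynomial.X) * naraB (n + 1)) := by
  have e₁ : (1 - Polynomial.X) ^ 2 * naraB n = naraB n - 2 * (Polynomial.X * naraB n)
      + Polynomial.X * (Polynomial.X * naraB n) := by ring
  have e₂ : (1 + Polynomial.X) * naraB (n + 1) =
      naraB (n + 1) + Polynomial.X * naraB (n + 1) := by ring
  rw [e₁, e₂]
  ext k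
  rcases k with _ | _ | k
  · simp [coeff_naraB, mul_coeff_zero]
    ring
  · simp only [zero_add, coeff_add, coeff_sub, coeff_C_mul, coeff_naraB, coeff_ofNat_mul,
      coeff_X_mul _ 0, mul_coeff_zero, coeff_X_zero, Nat.choose_one_right,
      Nat.choose_zero_right]
    push_cast
    ring
  · have h₁ := choose_succ_mul_succ_int n k
    have h₂ := choose_succ_mul_succ_int n (k + 1)
    push_cast at h₂
    simp only [coeff_add, coeff_sub, coeff_C_mul, coeff_X_mul, coeff_naraB, coeff_ofNat_mul,
      Nat.choose_succ_succ']
    push_cast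
    generalize (Nat.choose n k : ℤ) = a at *
    generalize (Nat.choose n (k + 1) : ℤ) = b at *
    generalize (Nat.choose n (k + 1 + 1) : ℤ) = d at *
    linear_combination (-2 * d - 2 * b) * h₁ + (2 * a + 2 * b) * h₂

theorem two_mul_X_mul_adjacentChoosePoly (n : ℕ) :
    2 * (Polynomial.X * adjacentChoosePoly n) =
      naraB (n + 1) - (1 + Polynomial.X) * naraB n := by
  have e : (1 + Polynomial.X) * naraB n = naraB n + Polynomial.X * naraB n := by ring
  rw [e]
  ext k
  rcases k with _ | k
  · simp [coeff_naraB]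
  · simp only [coeff_add, coeff_sub, coeff_X_mul, coeff_naraB, coeff_ofNat_mul,
      coeff_adjacentChoosePoly, Nat.choose_succ_succ']
    push_cast
    ring

theorem two_mul_X_mul_naraPoly_succ (n : ℕ) :
    2 * (Polynomial.X * naraPoly (n + 1)) =
      2 * (1 + Polynomial.X) * naraB (n + 1) - naraB (n + 2) -
        (1 - Polynomial.X) ^ 2 * naraB n := by
  have e₁ : (1 - Polynomial.X) ^ 2 * naraB n = naraB n - 2 * (Polynomial.X * naraB n)
      + Polynomial.X * (Polynomial.X * naraB n) := by ring
  have e₂ : 2 * (1 + Polynomial.X) * naraB (n + 1) =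
      2 * (naraB (n + 1) + Polynomial.X * naraB (n + 1)) := by ring
  rw [e₁, e₂]
  ext k
  rcases k with _ | _ | k
  · simp [coeff_naraB, mul_coeff_zero]
  · simp [coeff_naraB, coeff_X_mul, coeff_ofNat_mul, coeff_naraPoly_succ, naraNum_succ_zero]
    ring
  · simp only [coeff_add, coeff_sub, coeff_X_mul, coeff_naraB, coeff_ofNat_mul,
      coeff_naraPoly_succ, naraNum_succ_succ, Nat.choose_succ_succ']
    push_cast
    ring

theorem c_two_mul_add_one (n : ℕ) :
    c (2 * n + 1) = (naraB n).comp (Polynomial.X ^ 2) +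
      Polynomial.X * (adjacentChoosePoly n).comp (Polynomial.X ^ 2) := by
  simp only [← expand_eq_comp_X_pow]
  ext k
  rw [coeff_c_succ, v, coeff_add, coeff_expand two_pos, coeff_naraB]
  rcases Nat.even_or_odd' k with ⟨j, rfl | rfl⟩
  · have h₁ : (2 * n + 1 - 1) / 2 = n := by omega
    have h₂ : (2 * n + 1) / 2 = n := by omega
    have h₃ : 2 * j / 2 = j := by omega
    have h₄ : (2 * j + 1) / 2 = j := by omega
    rw [h₁, h₂, h₃, h₄]
    rcases j with _ | j
    · simp
    · have h₅ : 2 * (j + 1) = 2 * j + 1 + 1 := by ring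
      rw [if_pos ⟨_, rfl⟩, h₅, coeff_X_mul, coeff_expand two_pos, if_neg (by omega)]
      push_cast
      ring
  · have h₁ : (2 * n + 1 - 1) / 2 = n := by omega
    have h₂ : (2 * n + 1) / 2 = n := by omega
    have h₃ : 2 * j / 2 = j := by omega
    have h₄ : (2 * j + 1) / 2 = j := by omega
    have h₅ : (2 * j + 1 + 1) / 2 = j + 1 := by omega
    rw [if_neg (by omega), h₁, h₂, h₄, h₅, coeff_X_mul, coeff_expand two_pos, if_pos ⟨_, rfl⟩, h₃,
      coeff_adjacentChoosePoly]
    push_cast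
    ring

theorem c_two_mul_add_two (n : ℕ) :
    c (2 * n + 2) = (1 + Polynomial.X) * c (2 * n + 1) := by
  rw [add_mul, one_mul]
  have h₁ : (2 * n + 1 + 1 - 1) / 2 = n := by omega
  have h₂ : (2 * n + 1 + 1) / 2 = n + 1 := by omega
  have h₃ : (2 * n + 1 - 1) / 2 = n := by omega
  have h₄ : (2 * n + 1) / 2 = n := by omega
  ext k
  rcases k with _ | k
  · simp [coeff_c_succ, v]
  · rw [coeff_add, coeff_X_mul]
    simp only [coeff_c_succ, v, h₁, h₂, h₃, h₄]
    rcases Nat.even_or_odd' k with ⟨j, rfl | rfl⟩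
    · have h₅ : (2 * j + 1) / 2 = j := by omega
      have h₆ : (2 * j + 1 + 1) / 2 = j + 1 := by omega
      have h₇ : 2 * j / 2 = j := by omega
      rw [h₅, h₆, h₇, Nat.choose_succ_succ']
      push_cast
      ring
    · have h₅ : (2 * j + 1) / 2 = j := by omega
      have h₆ : (2 * j + 1 + 1) / 2 = j + 1 := by omega
      have h₇ : (2 * j + 1 + 1 + 1) / 2 = j + 1 := by omega
      rw [h₅, h₆, h₇, Nat.choose_succ_succ']
      push_cast
      ring

/-- The power series `∑ naraB n (t²) wⁿ`. -/
noncomputable def naraBSeries : PowerSeries (Polynomial ℤ) :=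
  PowerSeries.mk fun n => (naraB n).comp (Polynomial.X ^ 2)

/-- The power series `∑ c_{2n+1} wⁿ`. -/
noncomputable def oddCSeries : PowerSeries (Polynomial ℤ) :=
  PowerSeries.mk fun n => c (2 * n + 1)

/-- The power series `∑ C_{n+1}(t²) wⁿ`. -/
noncomputable def naraSeries : PowerSeries (Polynomial ℤ) :=
  PowerSeries.mk fun n => (naraPoly (n + 1)).comp (Polynomial.X ^ 2)

/-- The linear factor `1 - (1 + a t)² w`. -/
noncomputable def discrFactor (a : Polynomial ℤ) : PowerSeries (Polynomial ℤ) :=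
  1 - PowerSeries.C ((1 + a * Polynomial.X) ^ 2) * PowerSeries.X

theorem naraB_zero : naraB 0 = 1 := by simp [naraB]

theorem naraB_one : naraB 1 = 1 + Polynomial.X := by simp [naraB, Finset.sum_range_succ]

theorem discrFactor_mul_discrFactor :
    discrFactor 1 * discrFactor (-1) = 1 -
      PowerSeries.C (2 * (1 + Polynomial.X ^ 2)) * PowerSeries.X +
      PowerSeries.C ((1 - Polynomial.X ^ 2) ^ 2) * (PowerSeries.X * PowerSeries.X) := by
  simp only [discrFactor, map_mul, map_add, map_sub, map_pow, map_one, map_ofNat, map_neg]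
  ring

theorem discr_mul_naraBSeries :
    discrFactor 1 * discrFactor (-1) * naraBSeries =
      1 - PowerSeries.C (1 + Polynomial.X ^ 2) * PowerSeries.X -
        PowerSeries.C (2 * Polynomial.X ^ 2) * (PowerSeries.X * (PowerSeries.X * naraSeries)) := by
  have e : discrFactor 1 * discrFactor (-1) * naraBSeries = naraBSeries -
      PowerSeries.C (2 * (1 + Polynomial.X ^ 2)) * (PowerSeries.X * naraBSeries) +
      PowerSeries.C ((1 - Polynomial.X ^ 2) ^ 2) *
        (PowerSeries.X * (PowerSeries.X * naraBSeries)) := by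
    rw [discrFactor_mul_discrFactor]; ring
  rw [e]
  refine PowerSeries.ext fun n => ?_
  rcases n with _ | _ | n
  · simp [naraBSeries, naraB_zero]
  · simp only [naraBSeries, naraB_zero, map_add, map_sub, PowerSeries.coeff_C_mul,
      PowerSeries.coeff_succ_X_mul, PowerSeries.coeff_zero_X_mul, PowerSeries.coeff_mk,
      PowerSeries.coeff_one, one_comp]
    simp [naraB_one]
    ring
  · have h := congrArg (fun p => p.comp (Polynomial.X ^ 2)) (two_mul_X_mul_naraPoly_succ n)
    simp only [mul_comp, sub_comp, add_comp, pow_comp, X_comp, one_comp, ofNat_comp] at h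
    push_cast at h
    rw [map_sub (PowerSeries.coeff (n + 1 + 1)), map_sub (PowerSeries.coeff (n + 1 + 1)),
      map_add (PowerSeries.coeff (n + 1 + 1)), map_sub (PowerSeries.coeff (n + 1 + 1))]
    simp only [naraBSeries, naraSeries, PowerSeries.coeff_C_mul,
      PowerSeries.coeff_succ_X_mul, PowerSeries.coeff_mk, PowerSeries.coeff_X,
      PowerSeries.coeff_one, Nat.add_eq_zero_iff, one_ne_zero, and_false, if_false,
      Nat.add_eq_right]
    linear_combination h

theorem two_mul_X_mul_oddCSeries :
    PowerSeries.C (2 * Polynomial.X) * (PowerSeries.X * oddCSeries) =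
      discrFactor (-1) * naraBSeries - 1 := by
  have e : discrFactor (-1) * naraBSeries =
      naraBSeries - PowerSeries.C ((1 - Polynomial.X) ^ 2) * (PowerSeries.X * naraBSeries) := by
    simp only [discrFactor]; ring_nf
  rw [e]
  refine PowerSeries.ext fun n => ?_
  rcases n with _ | n
  · simp [naraBSeries, naraB_zero]
  · have h := congrArg (fun p => p.comp (Polynomial.X ^ 2)) (two_mul_X_mul_adjacentChoosePoly n)
    simp only [mul_comp, sub_comp, add_comp, X_comp, one_comp, ofNat_comp] at h
    simp only [naraBSeries, oddCSeries, map_sub, PowerSeries.coeff_C_mul,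
      PowerSeries.coeff_succ_X_mul, PowerSeries.coeff_mk, PowerSeries.coeff_one,
      c_two_mul_add_one]
    simp
    linear_combination h

theorem PowerSeries.mul_sq_eq_one_of_derivative {R : Type*} [CommRing R] [IsAddTorsionFree R]
    {D f : PowerSeries R}
    (h : 2 * (D * PowerSeries.derivative R f) + PowerSeries.derivative R D * f = 0)
    (h₀ : PowerSeries.constantCoeff D * PowerSeries.constantCoeff f ^ 2 = 1) :
    D * f ^ 2 = 1 := by
  refine PowerSeries.derivative.ext ?_ (by simpa using h₀)
  rw [Derivation.leibniz, PowerSeries.derivative_pow, PowerSeries.derivative_one]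
  simp only [smul_eq_mul, Nat.cast_ofNat]
  linear_combination f * h

theorem PowerSeries.derivative_quadratic {R : Type*} [CommRing R] (a b : R) :
    PowerSeries.derivative R (1 - PowerSeries.C a * PowerSeries.X +
        PowerSeries.C b * (PowerSeries.X * PowerSeries.X)) =
      - PowerSeries.C a + 2 * (PowerSeries.C b * PowerSeries.X) := by
  simp [Derivation.leibniz]
  ring

theorem discr_mul_derivative_naraBSeries :
    discrFactor 1 * discrFactor (-1) * PowerSeries.derivative _ naraBSeries =
      PowerSeries.C (1 + Polynomial.X ^ 2) * naraBSeries -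
        PowerSeries.C ((1 - Polynomial.X ^ 2) ^ 2) * (PowerSeries.X * naraBSeries) := by
  have e : discrFactor 1 * discrFactor (-1) * PowerSeries.derivative _ naraBSeries =
      PowerSeries.derivative _ naraBSeries -
      PowerSeries.C (2 * (1 + Polynomial.X ^ 2)) *
        (PowerSeries.X * PowerSeries.derivative _ naraBSeries) +
      PowerSeries.C ((1 - Polynomial.X ^ 2) ^ 2) *
        (PowerSeries.X * (PowerSeries.X * PowerSeries.derivative _ naraBSeries)) := by
    rw [discrFactor_mul_discrFactor]; ring
  have hd (n : ℕ) : PowerSeries.coeff n (PowerSeries.derivative _ naraBSeries) =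
      (naraB (n + 1)).comp (Polynomial.X ^ 2) * (n + 1) := by
    rw [PowerSeries.coeff_derivative, naraBSeries, PowerSeries.coeff_mk]
  have hr (n : ℕ) := congrArg (fun p => p.comp (Polynomial.X ^ 2)) (naraB_add_two_recurrence n)
  simp only [mul_comp, sub_comp, add_comp, pow_comp, X_comp, one_comp, natCast_comp, ofNat_comp,
    map_add, map_mul, map_natCast, map_one, map_ofNat] at hr
  have hc (n : ℕ) : PowerSeries.coeff n naraBSeries = (naraB n).comp (Polynomial.X ^ 2) :=
    PowerSeries.coeff_mk _ _
  rw [e]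
  refine PowerSeries.ext fun n => ?_
  rw [map_add (PowerSeries.coeff n), map_sub (PowerSeries.coeff n),
    map_sub (PowerSeries.coeff n)]
  rcases n with _ | _ | n
  · simp only [PowerSeries.coeff_C_mul, PowerSeries.coeff_zero_X_mul, hd]
    simp [naraBSeries, naraB_zero, naraB_one]
  · have h := hr 0
    simp only [PowerSeries.coeff_C_mul, PowerSeries.coeff_succ_X_mul,
      PowerSeries.coeff_zero_X_mul, hd, hc]
    push_cast at h ⊢
    simp only [zero_add] at h ⊢
    linear_combination h
  · have h := hr (n + 1)
    simp only [PowerSeries.coeff_C_mul, PowerSeries.coeff_succ_X_mul, hd, hc]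
    push_cast at h ⊢
    linear_combination h

theorem discr_mul_naraBSeries_sq :
    discrFactor 1 * discrFactor (-1) * naraBSeries ^ 2 = 1 := by
  refine PowerSeries.mul_sq_eq_one_of_derivative ?_ ?_
  · rw [discr_mul_derivative_naraBSeries, discrFactor_mul_discrFactor,
      PowerSeries.derivative_quadratic]
    simp only [map_mul, map_ofNat]
    ring
  · simp [discrFactor, naraBSeries, naraB_zero]

theorem oddCSeries_sq_mul_discrFactor :
    oddCSeries ^ 2 * discrFactor 1 = naraSeries := by
  have hne : PowerSeries.C (2 * Polynomial.X : Polynomial ℤ) * PowerSeries.X ≠ 0 :=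
    mul_ne_zero
      ((map_ne_zero_iff _ PowerSeries.C_injective).2 (mul_ne_zero two_ne_zero Polynomial.X_ne_zero))
      PowerSeries.X_ne_zero
  have h₁ := discr_mul_naraBSeries
  have h₂ := two_mul_X_mul_oddCSeries
  have h₃ := discr_mul_naraBSeries_sq
  apply mul_left_cancel₀ (pow_ne_zero 2 hne)
  have h₄ : discrFactor 1 + discrFactor (-1) =
      2 * (1 - PowerSeries.C (1 + Polynomial.X ^ 2) * PowerSeries.X) := by
    simp only [discrFactor, map_mul, map_add, map_pow, map_one, map_neg]
    ring
  have h₅ : (PowerSeries.C (2 * Polynomial.X : Polynomial ℤ)) ^ 2 =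
      2 * PowerSeries.C (2 * Polynomial.X ^ 2) := by
    simp only [map_mul, map_pow, map_ofNat]; ring
  linear_combination (discrFactor 1 * (PowerSeries.C (2 * Polynomial.X) *
    (PowerSeries.X * oddCSeries) + discrFactor (-1) * naraBSeries - 1)) * h₂ +
    discrFactor (-1) * h₃ - 2 * h₁ + h₄ - PowerSeries.X ^ 2 * naraSeries * h₅

theorem mk_pow_mul_c (ε : Polynomial ℤ) (hε : ε ^ 2 = 1) :
    PowerSeries.mk (fun n => ε ^ n * c (n + 1)) =
      PowerSeries.expand 2 two_ne_zero oddCSeries +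
      PowerSeries.C (ε * (1 + Polynomial.X)) *
        (PowerSeries.X * PowerSeries.expand 2 two_ne_zero oddCSeries) := by
  refine PowerSeries.ext fun n => ?_
  rw [map_add, PowerSeries.coeff_C_mul, PowerSeries.coeff_mk, PowerSeries.coeff_expand]
  rcases Nat.even_or_odd' n with ⟨j, rfl | rfl⟩
  · rw [if_pos ⟨_, rfl⟩, pow_mul, hε, one_pow, one_mul, Nat.mul_div_cancel_left _ two_pos]
    rcases j with _ | j
    · simp [oddCSeries]
    · rw [show 2 * (j + 1) = 2 * j + 1 + 1 by ring, PowerSeries.coeff_succ_X_mul,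
        PowerSeries.coeff_expand, if_neg (by omega)]
      simp [oddCSeries, mul_add]
  · rw [if_neg (by omega), PowerSeries.coeff_succ_X_mul, PowerSeries.coeff_expand,
      if_pos ⟨_, rfl⟩, Nat.mul_div_cancel_left _ two_pos, pow_succ, pow_mul, hε, one_pow]
    simp only [oddCSeries, PowerSeries.coeff_mk, c_two_mul_add_two]
    ring

/-- `g(t,z) · g(t,-z) = G(t²,z²)`: the coefficient of `z^{2n}` of the product is
`C_{n+1}(t²)` and the odd coefficients vanish. -/
theorem statement14 :
    PowerSeries.mk (fun n => c (n + 1)) *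
        PowerSeries.mk (fun n => (-1) ^ n * c (n + 1)) =
      PowerSeries.mk (fun n =>
        if Even n then (naraPoly (n / 2 + 1)).comp (Polynomial.X ^ 2) else 0) := by
  have h₁ := mk_pow_mul_c 1 (by ring)
  have h₂ := mk_pow_mul_c (-1) (by ring)
  simp only [one_pow, one_mul] at h₁
  have h₃ : PowerSeries.mk (fun n =>
      if Even n then (naraPoly (n / 2 + 1)).comp (Polynomial.X ^ 2) else 0) =
      PowerSeries.expand 2 two_ne_zero naraSeries := by
    refine PowerSeries.ext fun n => ?_
    simp only [PowerSeries.coeff_mk, PowerSeries.coeff_expand, naraSeries, even_iff_two_dvd]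
  rw [h₁, h₂, h₃, ← oddCSeries_sq_mul_discrFactor]
  simp only [discrFactor, map_mul, map_pow, map_sub, map_one, PowerSeries.expand_C,
    PowerSeries.expand_X, map_neg, map_add]
  ring
end

section
/- For every n ≥ 0, the Hankel determinant of the polynomials c_m(t) satisfies det((c_{i+j}(t))_{i,j=0}^{n-1}) = t^{C(n,2)} in ℤ[t], where C(n,2) = n(n-1)/2. -/
open Polynomial Finset

/-- The Stieltjes matrix of the Jacobi continued fraction with diagonal coefficients `b` and
constant off-diagonal weight `t`. -/
def stieltjes {R : Type*} [CommRing R] (b : ℕ → R) (t : R) : ℕ → ℕ → R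
  | 0, 0 => 1
  | 0, _ + 1 => 0
  | n + 1, 0 => b 0 * stieltjes b t n 0 + t * stieltjes b t n 1
  | n + 1, k + 1 =>
    stieltjes b t n k + b (k + 1) * stieltjes b t n (k + 1) + t * stieltjes b t n (k + 2)

section Stieltjes

variable {R : Type*} [CommRing R] (b : ℕ → R) (t : R)

theorem stieltjes_eq_zero_of_lt {n k : ℕ} (h : n < k) : stieltjes b t n k = 0 := by
  induction n generalizing k with
  | zero =>
    obtain ⟨k, rfl⟩ := Nat.exists_eq_succ_of_ne_zero h.ne'
    simp [stieltjes]
  | succ n ih =>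
    obtain ⟨k, rfl⟩ := Nat.exists_eq_succ_of_ne_zero (Nat.ne_zero_of_lt h)
    rw [Nat.succ_eq_add_one, stieltjes, ih (by lia), ih (by lia), ih (by lia)]
    ring

theorem stieltjes_self (n : ℕ) : stieltjes b t n n = 1 := by
  induction n with
  | zero => simp [stieltjes]
  | succ n ih =>
    rw [stieltjes, ih, stieltjes_eq_zero_of_lt b t (by lia : n < n + 1),
      stieltjes_eq_zero_of_lt b t (by lia : n < n + 2)]
    ring

theorem sum_stieltjes_succ_mul_sub (m n N : ℕ) :
    ∑ k ∈ range (N + 1), t ^ k * stieltjes b t (m + 1) k * stieltjes b t n k -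
        ∑ k ∈ range (N + 1), t ^ k * stieltjes b t m k * stieltjes b t (n + 1) k =
      t ^ (N + 1) * (stieltjes b t m (N + 1) * stieltjes b t n N -
        stieltjes b t m N * stieltjes b t n (N + 1)) := by
  induction N with
  | zero =>
    simp only [zero_add, sum_range_one, stieltjes]
    ring
  | succ N ih =>
    rw [sum_range_succ, sum_range_succ _ (N + 1), add_sub_add_comm, ih, stieltjes, stieltjes]
    ring

theorem sum_stieltjes_mul {m n N : ℕ} (h : m + n < N) :
    ∑ k ∈ range N, t ^ k * stieltjes b t m k * stieltjes b t n k = stieltjes b t (m + n) 0 := by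
  induction m generalizing n with
  | zero =>
    rw [sum_eq_single_of_mem 0 (by simp; lia)]
    · simp [stieltjes]
    · intro k _ hk
      rw [stieltjes_eq_zero_of_lt b t (Nat.pos_of_ne_zero hk)]
      ring
  | succ m ih =>
    obtain ⟨N, rfl⟩ := Nat.exists_eq_succ_of_ne_zero (Nat.ne_zero_of_lt h)
    have key := sum_stieltjes_succ_mul_sub b t m n N
    rw [stieltjes_eq_zero_of_lt b t (by lia : m < N + 1),
      stieltjes_eq_zero_of_lt b t (by lia : n < N + 1), zero_mul, mul_zero, sub_zero, mul_zero,
      sub_eq_zero] at key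
    rw [Nat.succ_eq_add_one, key, ih (by lia), add_right_comm, add_assoc]

theorem det_hankel_stieltjes (n : ℕ) :
    Matrix.det (Matrix.of fun i j : Fin n => stieltjes b t ((i : ℕ) + (j : ℕ)) 0) =
      t ^ n.choose 2 := by
  let L : Matrix (Fin n) (Fin n) R := Matrix.of fun i k => stieltjes b t i k
  have hL : L.det = 1 := by
    rw [Matrix.det_of_isLowerTriangular]
    · simp [L, stieltjes_self]
    · intro i k hik
      exact stieltjes_eq_zero_of_lt b t (by simpa using hik)
  have hfac : (Matrix.of fun i j : Fin n => stieltjes b t ((i : ℕ) + (j : ℕ)) 0) =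
      L * Matrix.diagonal (fun k : Fin n => t ^ (k : ℕ)) * L.transpose := by
    ext i j
    rw [Matrix.of_apply, ← sum_stieltjes_mul b t (Nat.lt_succ_self ((i : ℕ) + j) |>.trans_le
      (by lia : (i : ℕ) + j + 1 ≤ n + n)), Matrix.mul_apply]
    simp only [Matrix.mul_diagonal, Matrix.transpose_apply, L, Matrix.of_apply]
    rw [Fin.sum_univ_eq_sum_range
      (fun k => stieltjes b t i k * t ^ k * stieltjes b t j k), eq_comm]
    refine (sum_congr rfl fun k _ => by ring).trans
      (sum_subset (range_subset_range.2 (Nat.le_add_left n n)) fun k _ hk => ?_)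
    rw [stieltjes_eq_zero_of_lt b t (by simp at hk; lia : (i : ℕ) < k)]
    ring
  rw [hfac, Matrix.det_mul, Matrix.det_mul, Matrix.det_transpose, hL, Matrix.det_diagonal,
    Fin.prod_univ_eq_prod_range (fun k => t ^ k), prod_pow_eq_pow_sum, sum_range_id,
    Nat.choose_two_right, one_mul, mul_one]

end Stieltjes

/-- The generating polynomial `∑ j, C(m, j) C(m, j + i) t ^ (2 j)`. -/
noncomputable def narayanaSum (m i : ℕ) : ℤ[X] :=
  ∑ j ∈ range (m + 1), (m.choose j : ℤ[X]) * (m.choose (j + i) : ℤ[X]) * X ^ (2 * j)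

theorem narayanaSum_eq_sum_range {m N : ℕ} (i : ℕ) (h : m < N) :
    narayanaSum m i =
      ∑ j ∈ range N, (m.choose j : ℤ[X]) * (m.choose (j + i) : ℤ[X]) * X ^ (2 * j) := by
  refine sum_subset (range_subset_range.2 h) fun j _ hj => ?_
  rw [Nat.choose_eq_zero_of_lt (by simp at hj; lia)]
  simp

theorem sum_choose_mul_choose_succ (m i : ℕ) :
    ∑ j ∈ range (m + 1),
        (m.choose (j + 1) : ℤ[X]) * (m.choose (j + 1 + i) : ℤ[X]) * X ^ (2 * (j + 1)) =
      narayanaSum m i - m.choose i := by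
  rw [narayanaSum_eq_sum_range i (by lia : m < m + 2), sum_range_succ' _ (m + 1)]
  simp

theorem narayanaSum_succ_succ (m i : ℕ) :
    narayanaSum (m + 1) (i + 1) = narayanaSum m i + (1 + X ^ 2) * narayanaSum m (i + 1) +
      X ^ 2 * narayanaSum m (i + 2) := by
  have h₀ := sum_choose_mul_choose_succ m i
  have h₁ := sum_choose_mul_choose_succ m (i + 1)
  rw [narayanaSum, sum_range_succ']
  have : ∀ j : ℕ, ((m + 1).choose (j + 1) : ℤ[X]) * ((m + 1).choose (j + 1 + (i + 1)) : ℤ[X]) *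
      X ^ (2 * (j + 1)) =
      (m.choose (j + 1) : ℤ[X]) * (m.choose (j + 1 + i) : ℤ[X]) * X ^ (2 * (j + 1)) +
      (m.choose (j + 1) : ℤ[X]) * (m.choose (j + 1 + (i + 1)) : ℤ[X]) * X ^ (2 * (j + 1)) +
      X ^ 2 * ((m.choose j : ℤ[X]) * (m.choose (j + (i + 1)) : ℤ[X]) * X ^ (2 * j)) +
      X ^ 2 * ((m.choose j : ℤ[X]) * (m.choose (j + (i + 2)) : ℤ[X]) * X ^ (2 * j)) := by
    intro j
    rw [Nat.choose_succ_succ' m j, show j + 1 + (i + 1) = j + 1 + i + 1 by ring,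
      Nat.choose_succ_succ' m (j + 1 + i), show j + (i + 1) = j + 1 + i by ring,
      show j + (i + 2) = j + 1 + i + 1 by ring]
    push_cast
    ring
  simp only [this, sum_add_distrib, ← mul_sum, h₀, h₁, zero_add, Nat.choose_succ_succ' m i,
    Nat.choose_zero_right, mul_zero, pow_zero]
  push_cast
  simp only [narayanaSum]
  ring

theorem narayanaSum_succ_zero (m : ℕ) :
    narayanaSum (m + 1) 0 = (1 + X ^ 2) * narayanaSum m 0 + 2 * X ^ 2 * narayanaSum m 1 := by
  have h₀ := sum_choose_mul_choose_succ m 0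
  rw [narayanaSum, sum_range_succ']
  have : ∀ j : ℕ, ((m + 1).choose (j + 1) : ℤ[X]) * ((m + 1).choose (j + 1 + 0) : ℤ[X]) *
      X ^ (2 * (j + 1)) =
      (m.choose (j + 1) : ℤ[X]) * (m.choose (j + 1 + 0) : ℤ[X]) * X ^ (2 * (j + 1)) +
      X ^ 2 * ((m.choose j : ℤ[X]) * (m.choose (j + 0) : ℤ[X]) * X ^ (2 * j)) +
      2 * X ^ 2 * ((m.choose j : ℤ[X]) * (m.choose (j + 1) : ℤ[X]) * X ^ (2 * j)) := by
    intro j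
    rw [add_zero, add_zero, Nat.choose_succ_succ' m j]
    push_cast
    ring
  simp only [this, sum_add_distrib, ← mul_sum, h₀, zero_add, Nat.choose_zero_right, mul_zero,
    pow_zero]
  push_cast
  simp only [narayanaSum]
  ring

theorem sum_range_two_mul {M : Type*} [AddCommMonoid M] (f : ℕ → M) (n : ℕ) :
    ∑ k ∈ range (2 * n), f k = ∑ j ∈ range n, f (2 * j) + ∑ j ∈ range n, f (2 * j + 1) := by
  induction n with
  | zero => simp
  | succ n ih =>
    rw [mul_add, mul_one, sum_range_succ, sum_range_succ, ih, sum_range_succ, sum_range_succ]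
    abel

theorem c_odd (m : ℕ) : c (2 * m + 1) = narayanaSum m 0 + X * narayanaSum m 1 := by
  have h : c (2 * m + 1) =
      ∑ k ∈ range (2 * (m + 1)), C (v (2 * m + 1) k : ℤ) * X ^ k := by
    rw [c, mul_add, mul_one, sum_range_succ _ (2 * m + 1), v,
      Nat.choose_eq_zero_of_lt (by lia : (2 * m + 1) / 2 < (2 * m + 1 + 1) / 2)]
    simp
  rw [h, sum_range_two_mul, narayanaSum, narayanaSum, mul_sum]
  congr 1 <;> refine sum_congr rfl fun j _ => ?_
  · rw [v, show (2 * m + 1 - 1) / 2 = m by lia, show (2 * m + 1) / 2 = m by lia,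
      show 2 * j / 2 = j by lia, show (2 * j + 1) / 2 = j by lia]
    simp
  · rw [v, show (2 * m + 1 - 1) / 2 = m by lia, show (2 * m + 1) / 2 = m by lia,
      show (2 * j + 1) / 2 = j by lia, show (2 * j + 1 + 1) / 2 = j + 1 by lia]
    simp
    ring

theorem c_even (m : ℕ) :
    c (2 * m + 2) = (1 + X) * (narayanaSum m 0 + X * narayanaSum m 1) := by
  have h₀ := sum_choose_mul_choose_succ m 0
  rw [eq_sub_iff_add_eq] at h₀
  have he : ∑ j ∈ range (m + 1), C (v (2 * m + 2) (2 * j) : ℤ) * X ^ (2 * j) =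
      narayanaSum m 0 + X ^ 2 * narayanaSum m 1 := by
    have hv : ∀ j, v (2 * m + 2) (2 * j) = m.choose j * (m + 1).choose j := fun j => by
      rw [v, show (2 * m + 2 - 1) / 2 = m by lia, show (2 * m + 2) / 2 = m + 1 by lia,
        show 2 * j / 2 = j by lia, show (2 * j + 1) / 2 = j by lia]
    have hs : ∑ j ∈ range (m + 1), C (v (2 * m + 2) (2 * j) : ℤ) * X ^ (2 * j) =
        ∑ j ∈ range (m + 2), C (v (2 * m + 2) (2 * j) : ℤ) * X ^ (2 * j) := by
      rw [sum_range_succ _ (m + 1), hv (m + 1), Nat.choose_succ_self]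
      simp
    rw [hs, sum_range_succ', ← h₀]
    simp only [narayanaSum, mul_sum, hv]
    have : ∀ j : ℕ, (C ((m.choose (j + 1) * (m + 1).choose (j + 1) : ℕ) : ℤ) : ℤ[X]) *
        X ^ (2 * (j + 1)) =
        (m.choose (j + 1) : ℤ[X]) * (m.choose (j + 1 + 0) : ℤ[X]) * X ^ (2 * (j + 1)) +
        X ^ 2 * ((m.choose j : ℤ[X]) * (m.choose (j + 1) : ℤ[X]) * X ^ (2 * j)) := by
      intro j
      rw [Nat.choose_succ_succ' m j]
      simp
      ring
    simp only [this, sum_add_distrib]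
    simp
    ring
  have ho : ∑ j ∈ range (m + 1), C (v (2 * m + 2) (2 * j + 1) : ℤ) * X ^ (2 * j + 1) =
      X * (narayanaSum m 0 + narayanaSum m 1) := by
    rw [narayanaSum, narayanaSum, ← sum_add_distrib, mul_sum]
    refine sum_congr rfl fun j _ => ?_
    rw [v, show (2 * m + 2 - 1) / 2 = m by lia, show (2 * m + 2) / 2 = m + 1 by lia,
      show (2 * j + 1) / 2 = j by lia, show (2 * j + 1 + 1) / 2 = j + 1 by lia,
      Nat.choose_succ_succ' m j]
    simp
    ring
  rw [c, show 2 * m + 1 + 1 = 2 * (m + 1) by ring, sum_range_two_mul,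
    show 2 * (m + 1) = 2 * m + 2 by ring, he, ho]
  ring

/-- The diagonal coefficients `1, t - 1, 1 - t, t - 1, …` of the Jacobi continued fraction of
`∑ n, c n * z ^ n`. -/
noncomputable def jacobiDiag : ℕ → ℤ[X]
  | 0 => 1
  | k + 1 => (-1) ^ k * (X - 1)

theorem jacobiDiag_odd (i : ℕ) : jacobiDiag (2 * i + 1) = X - 1 := by
  simp [jacobiDiag]

theorem jacobiDiag_even (i : ℕ) : jacobiDiag (2 * i + 2) = 1 - X := by
  rw [jacobiDiag, pow_succ, pow_mul]
  simp

theorem stieltjes_jacobiDiag_even {m : ℕ} {G : ℕ → ℤ[X]}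
    (h : ∀ i, stieltjes jacobiDiag X (2 * m + 1) (2 * i) = G i ∧
      stieltjes jacobiDiag X (2 * m + 1) (2 * i + 1) = G i) :
    stieltjes jacobiDiag X (2 * m + 2) 0 = (1 + X) * G 0 ∧
      (∀ i, stieltjes jacobiDiag X (2 * m + 2) (2 * i + 2) = G i + G (i + 1)) ∧
      ∀ i, stieltjes jacobiDiag X (2 * m + 2) (2 * i + 1) = X * (G i + G (i + 1)) := by
  refine ⟨?_, fun i => ?_, fun i => ?_⟩
  · have h₀ := (h 0).1
    have h₁ := (h 0).2
    simp only [mul_zero, zero_add] at h₀ h₁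
    rw [stieltjes, h₀, h₁, jacobiDiag]
    ring
  · rw [stieltjes, (h i).2, jacobiDiag_even, show 2 * i + 1 + 1 = 2 * (i + 1) by ring,
      show 2 * i + 1 + 2 = 2 * (i + 1) + 1 by ring, (h (i + 1)).1, (h (i + 1)).2]
    ring
  · rw [stieltjes, (h i).1, (h i).2, jacobiDiag_odd, show 2 * i + 2 = 2 * (i + 1) by ring,
      (h (i + 1)).1]
    ring

theorem stieltjes_jacobiDiag_odd (m i : ℕ) :
    stieltjes jacobiDiag X (2 * m + 1) (2 * i) = narayanaSum m i + X * narayanaSum m (i + 1) ∧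
      stieltjes jacobiDiag X (2 * m + 1) (2 * i + 1) =
        narayanaSum m i + X * narayanaSum m (i + 1) := by
  induction m generalizing i with
  | zero =>
    cases i <;> simp [mul_add, stieltjes, narayanaSum, jacobiDiag]
  | succ m ih =>
    obtain ⟨hz, he, ho⟩ := stieltjes_jacobiDiag_even
      (G := fun i => narayanaSum m i + X * narayanaSum m (i + 1)) ih
    rw [show 2 * (m + 1) + 1 = 2 * m + 2 + 1 by ring]
    cases i with
    | zero =>
      have ho₀ := ho 0
      have he₀ := he 0
      simp only [mul_zero, zero_add] at ho₀ he₀ ⊢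
      constructor
      · rw [stieltjes, hz, ho₀, jacobiDiag, narayanaSum_succ_zero, narayanaSum_succ_succ]
        ring
      · rw [stieltjes, hz, ho₀, he₀, narayanaSum_succ_zero, narayanaSum_succ_succ,
          show jacobiDiag (0 + 1) = X - 1 from jacobiDiag_odd 0]
        ring
    | succ i =>
      have ho₁ := ho (i + 1)
      have he₁ := he (i + 1)
      rw [narayanaSum_succ_succ, narayanaSum_succ_succ]
      constructor
      · rw [show 2 * (i + 1) = 2 * i + 1 + 1 by ring, stieltjes, ho,
          show 2 * i + 1 + 2 = 2 * (i + 1) + 1 by ring, ho₁, show 2 * i + 1 + 1 = 2 * i + 2 by ring,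
          he, jacobiDiag_even]
        ring
      · rw [stieltjes, ho₁, he₁, jacobiDiag_odd, show 2 * (i + 1) = 2 * i + 2 by ring, he]
        ring

theorem c_eq_stieltjes (n : ℕ) : c n = stieltjes jacobiDiag X n 0 := by
  obtain ⟨m, rfl | rfl⟩ := n.even_or_odd'
  · cases m with
    | zero => simp [c, stieltjes]
    | succ m =>
      rw [mul_add, mul_one, c_even, (stieltjes_jacobiDiag_even (stieltjes_jacobiDiag_odd m)).1]
  · rw [c_odd]
    exact (stieltjes_jacobiDiag_odd m 0).1.symm

/-- The Hankel determinant `det (c_{i+j}(t))_{i,j=0}^{n-1} = t^{C(n,2)}` in `ℤ[t]`. -/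
theorem statement15 (n : ℕ) :
    Matrix.det (Matrix.of fun i j : Fin n => c ((i : ℕ) + (j : ℕ))) =
      Polynomial.X ^ Nat.choose n 2 := by
  simp only [c_eq_stieltjes, det_hankel_stieltjes]
end

section
/- The generating function of the shifted polynomials c_{n+1} evaluated at t = -1 equals the generating function of the Catalan numbers in z²: ∑_{n≥0} c_{n+1}(-1) z^n = ∑_{n≥0} C_n z^{2n} as formal power series over ℤ, i.e. c_{2n+1}(-1) = C_n and c_{2n+2}(-1) = 0 for all n ≥ 0, where C_n denotes the n-th Catalan number. -/
open Polynomial Finset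

theorem sum_range_two_mul_neg_one_pow {R : Type*} [CommRing R] (f : ℕ → R) (m : ℕ) :
    ∑ k ∈ range (2 * m), f k * (-1) ^ k = ∑ j ∈ range m, (f (2 * j) - f (2 * j + 1)) := by
  induction m with
  | zero => simp
  | succ m ih =>
    rw [mul_add, mul_one, sum_range_succ, sum_range_succ, ih, sum_range_succ]
    simp only [pow_succ, pow_mul]
    ring

theorem sum_range_choose_mul_choose (m n k : ℕ) :
    ∑ j ∈ range (n + 1), n.choose j * m.choose (j + k) = (m + n).choose (n + k) := by
  have key := Nat.add_choose_eq n m (n + k)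
  rw [Nat.sum_antidiagonal_eq_sum_range_succ (fun i j => n.choose i * m.choose j),
    Nat.succ_eq_add_one, add_right_comm n k 1, sum_range_add] at key
  have tail : ∑ x ∈ range k, n.choose (n + 1 + x) * m.choose (n + k - (n + 1 + x)) = 0 :=
    sum_eq_zero fun x _ => by rw [Nat.choose_eq_zero_of_lt (by omega), zero_mul]
  rw [tail, add_zero, ← sum_range_reflect] at key
  rw [add_comm m n, key]
  refine sum_congr rfl fun j hj => ?_
  have hj : j ≤ n := Nat.lt_succ_iff.mp (mem_range.mp hj)
  rw [show n + 1 - 1 - j = n - j by omega, Nat.choose_symm hj,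
    show n + k - (n - j) = j + k by omega]

theorem catalan_eq_choose_sub_choose (n : ℕ) :
    (catalan n : ℤ) = (2 * n).choose n - (2 * n).choose (n + 1) := by
  have h₁ : ((n + 1 : ℕ) : ℤ) * catalan n = (2 * n).choose n := by
    exact_mod_cast succ_mul_catalan_eq_centralBinom n
  have h₂ : ((2 * n).choose (n + 1) : ℤ) * (n + 1) = (2 * n).choose n * n := by
    have h := Nat.choose_succ_right_eq (2 * n) n
    rw [show 2 * n - n = n by omega] at h
    exact_mod_cast h
  have h₃ : ((n : ℤ) + 1) ≠ 0 := by positivity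
  apply mul_left_cancel₀ h₃
  push_cast at h₁
  linear_combination h₁ + h₂

theorem eval_neg_one_c_succ (n : ℕ) :
    (c (n + 1)).eval (-1) = ∑ k ∈ range (n + 1), (v (n + 1) k : ℤ) * (-1) ^ k := by
  simp [c, eval_finsetSum]

theorem eval_neg_one_c_odd (n : ℕ) : (c (2 * n + 1)).eval (-1) = (catalan n : ℤ) := by
  have hv : ∀ k, v (2 * n + 1) k = n.choose (k / 2) * n.choose ((k + 1) / 2) := fun k => by
    rw [v, show (2 * n + 1 - 1) / 2 = n by omega, show (2 * n + 1) / 2 = n by omega]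
  have last : v (2 * n + 1) (2 * n + 1) = 0 := by
    rw [hv, show (2 * n + 1 + 1) / 2 = n + 1 by omega, Nat.choose_succ_self, mul_zero]
  have extend := sum_range_succ (fun k => (v (2 * n + 1) k : ℤ) * (-1) ^ k) (2 * n + 1)
  rw [last, Nat.cast_zero, zero_mul, add_zero] at extend
  have hv₀ : ∀ j, v (2 * n + 1) (2 * j) = n.choose j * n.choose (j + 0) := fun j => by
    rw [hv, show 2 * j / 2 = j by omega, show (2 * j + 1) / 2 = j + 0 by omega]
  have hv₁ : ∀ j, v (2 * n + 1) (2 * j + 1) = n.choose j * n.choose (j + 1) := fun j => by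
    rw [hv, show (2 * j + 1) / 2 = j by omega, show (2 * j + 1 + 1) / 2 = j + 1 by omega]
  rw [eval_neg_one_c_succ, ← extend, show 2 * n + 1 + 1 = 2 * (n + 1) by ring,
    sum_range_two_mul_neg_one_pow, sum_sub_distrib, ← Nat.cast_sum, ← Nat.cast_sum]
  simp only [hv₀, hv₁]
  rw [sum_range_choose_mul_choose, sum_range_choose_mul_choose, catalan_eq_choose_sub_choose,
    two_mul, add_zero]

theorem eval_neg_one_c_even (n : ℕ) : (c (2 * n + 2)).eval (-1) = 0 := by
  have hv₀ : ∀ j, v (2 * n + 1 + 1) (2 * j) = n.choose j * (n + 1).choose j := fun j => by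
    rw [v, show (2 * n + 1 + 1 - 1) / 2 = n by omega, show (2 * n + 1 + 1) / 2 = n + 1 by omega,
      show 2 * j / 2 = j by omega, show (2 * j + 1) / 2 = j by omega]
  have hv₁ : ∀ j, v (2 * n + 1 + 1) (2 * j + 1) = n.choose j * (n + 1).choose (j + 1) :=
    fun j => by
      rw [v, show (2 * n + 1 + 1 - 1) / 2 = n by omega, show (2 * n + 1 + 1) / 2 = n + 1 by omega,
        show (2 * j + 1) / 2 = j by omega, show (2 * j + 1 + 1) / 2 = j + 1 by omega]
  rw [eval_neg_one_c_succ, show range (2 * n + 1 + 1) = range (2 * (n + 1)) from rfl,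
    sum_range_two_mul_neg_one_pow, sum_sub_distrib, sub_eq_zero, ← sum_range_reflect]
  refine sum_congr rfl fun j hj => ?_
  have hj : j ≤ n := Nat.lt_succ_iff.mp (mem_range.mp hj)
  rw [hv₀, hv₁, show n + 1 - 1 - j = n - j by omega, Nat.choose_symm hj,
    ← Nat.choose_symm (show j + 1 ≤ n + 1 by omega), Nat.add_sub_add_right]

/-- `∑_{n≥0} c_{n+1}(-1) zⁿ = ∑_{n≥0} Cat_n z^{2n}` as formal power series over `ℤ`,
i.e. `c_{2n+1}(-1) = Cat_n` and `c_{2n+2}(-1) = 0` for all `n ≥ 0`. -/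
theorem statement18 :
    (PowerSeries.mk (fun n => (c (n + 1)).eval (-1)) : PowerSeries ℤ) =
        PowerSeries.mk (fun n => if Even n then (catalan (n / 2) : ℤ) else 0) ∧
      (∀ n : ℕ, (c (2 * n + 1)).eval (-1) = (catalan n : ℤ)) ∧
      (∀ n : ℕ, (c (2 * n + 2)).eval (-1) = 0) := by
  refine ⟨PowerSeries.ext fun n => ?_, eval_neg_one_c_odd, eval_neg_one_c_even⟩
  rw [PowerSeries.coeff_mk, PowerSeries.coeff_mk]
  obtain ⟨m, rfl | rfl⟩ := n.even_or_odd'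
  · rw [eval_neg_one_c_odd, if_pos (even_two_mul m), show 2 * m / 2 = m by omega]
  · rw [eval_neg_one_c_even, if_neg (Nat.not_even_two_mul_add_one m)]
end
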